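/- Let q ≥ 2 and M be positive integers, let S_1,…,S_M be independent random variables taking values in {0,…,q−1}, let ℓ ∈ {0,…,q−1}, and let θ be a nonnegative integer. Then there exists a partition of [1:M] into nonempty pairwise disjoint sets A_1,…,A_J such that for every cyclic shift d ∈ {0,…,J−1} the following holds: defining U^{(d)}_0 = 0 and U^{(d)}_m = U^{(d)}_{m−1} + ∑_{i∈A_{((m+d−1) mod J)+1}} 1{U^{(d)}_{m−1} < θ}·1{S_i = ℓ} for m ∈ [1:J], one has ∑_{m=1}^{J} H( U^{(d)}_m | U^{(d)}_{m−1} ) < (5/2)·log₂(1+θ) + 12. -/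

import Mathlib

open MeasureTheory ProbabilityTheory

/-- Shannon entropy (in bits) of a random variable `X` with respect to the measure `μ`:
`H(X) = -∑ₐ P(X = a) log₂ P(X = a)`, with the convention `0 · log₂ 0 = 0`. -/
noncomputable def shannonEntropy {Ω α : Type*} [MeasurableSpace Ω]
    (μ : Measure Ω) (X : Ω → α) : ℝ :=
  ∑' a : α, -((μ (X ⁻¹' {a})).toReal * Real.logb 2 (μ (X ⁻¹' {a})).toReal)

/-- Conditional Shannon entropy (in bits): `H(X | Y) = ∑_y P(Y = y) H(X | Y = y)`, where
`H(X | Y = y)` is the entropy under the conditional measure `μ[|Y ⁻¹' {y}]`. -/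
noncomputable def condShannonEntropy {Ω : Type*} [MeasurableSpace Ω]
    (μ : Measure Ω) (X Y : Ω → ℕ) : ℝ :=
  ∑' y : ℕ, (μ (Y ⁻¹' {y})).toReal * shannonEntropy (μ[|Y ⁻¹' {y}]) X

/-- The descriptions of the clipped frequency of the value `ℓ`:
`U₀ = 0` and `U_m = U_{m-1} + ∑_{i ∈ A_m} 1{U_{m-1} < θ} · 1{S i = ℓ}`. -/
def descr {Ω : Type*} {M : ℕ} (S : Fin M → Ω → ℕ) (ℓ θ : ℕ)
    (A : ℕ → Finset (Fin M)) : ℕ → Ω → ℕ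
  | 0, _ => 0
  | m + 1, ω =>
      descr S ℓ θ A m ω +
        if descr S ℓ θ A m ω < θ then ((A (m + 1)).filter fun i => S i ω = ℓ).card else 0

section Entropy

variable {Ω : Type*} [MeasurableSpace Ω] {μ : Measure Ω}

theorem shannonEntropy_const_add (X : Ω → ℕ) (y : ℕ) :
    shannonEntropy μ (fun ω => y + X ω) = shannonEntropy μ X := by
  unfold shannonEntropy
  rw [← (add_right_injective y).tsum_eq]
  · refine tsum_congr fun a => ?_
    have : (fun ω => y + X ω) ⁻¹' {y + a} = X ⁻¹' {a} := by ext ω; simp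
    rw [this]
  · intro a ha
    by_contra hne
    have : (fun ω => y + X ω) ⁻¹' {a} = ∅ := by
      ext ω
      simp only [Set.mem_preimage, Set.mem_singleton_iff, Set.mem_empty_iff_false, iff_false]
      exact fun h => hne ⟨X ω, h⟩
    simp [this] at ha

theorem shannonEntropy_cond_eq_zero [IsProbabilityMeasure μ] {X Y : Ω → ℕ} (hY : Measurable Y)
    {y : ℕ} (h : ∀ ω, Y ω = y → X ω = y) : shannonEntropy μ[|Y ⁻¹' {y}] X = 0 := by
  unfold shannonEntropy
  have hs : MeasurableSet (Y ⁻¹' {y}) := hY (measurableSet_singleton y)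
  refine (tsum_congr fun a => ?_).trans tsum_zero
  rw [cond_apply hs]
  by_cases hay : a = y
  · have : Y ⁻¹' {y} ∩ X ⁻¹' {a} = Y ⁻¹' {y} := by
      refine Set.inter_eq_left.2 fun ω hω => ?_
      simpa [hay] using h ω hω
    rw [this]
    by_cases h0 : μ (Y ⁻¹' {y}) = 0
    · simp [h0]
    · rw [ENNReal.inv_mul_cancel h0 (measure_ne_top _ _)]
      simp
  · have : Y ⁻¹' {y} ∩ X ⁻¹' {a} = ∅ := by
      ext ω
      simp only [Set.mem_inter_iff, Set.mem_preimage, Set.mem_singleton_iff,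
        Set.mem_empty_iff_false, iff_false, not_and]
      exact fun h1 h2 => hay (h2.symm.trans (h ω h1))
    simp [this]

theorem shannonEntropy_cond_eq_of_indepFun [IsProbabilityMeasure μ] {X U N : Ω → ℕ}
    (hU : Measurable U) (hind : IndepFun U N μ) {y : ℕ}
    (hX : ∀ ω, U ω = y → X ω = y + N ω) (h0 : μ (U ⁻¹' {y}) ≠ 0) :
    shannonEntropy μ[|U ⁻¹' {y}] X = shannonEntropy μ N := by
  rw [← shannonEntropy_const_add N y]
  unfold shannonEntropy
  have hs : MeasurableSet (U ⁻¹' {y}) := hU (measurableSet_singleton y)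
  refine tsum_congr fun a => ?_
  have : U ⁻¹' {y} ∩ X ⁻¹' {a} = U ⁻¹' {y} ∩ N ⁻¹' {n | y + n = a} := by
    ext ω
    simp only [Set.mem_inter_iff, Set.mem_preimage, Set.mem_singleton_iff, Set.mem_ofPred_eq]
    exact and_congr_right fun h => by rw [hX ω h]
  rw [cond_apply hs, this,
    hind.measure_inter_preimage_eq_mul _ _ (measurableSet_singleton y) (MeasurableSet.of_discrete),
    ← mul_assoc, ENNReal.inv_mul_cancel h0 (measure_ne_top _ _), one_mul]
  rfl

theorem condShannonEntropy_clipped_add [IsProbabilityMeasure μ] {U N : Ω → ℕ}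
    (hU : Measurable U) (hind : IndepFun U N μ) (θ : ℕ) :
    condShannonEntropy μ (fun ω => U ω + if U ω < θ then N ω else 0) U =
      μ.real {ω | U ω < θ} * shannonEntropy μ N := by
  unfold condShannonEntropy
  rw [tsum_eq_sum (s := Finset.range θ)]
  · have hset : {ω | U ω < θ} = U ⁻¹' (Finset.range θ : Set ℕ) := by ext ω; simp
    rw [hset, ← sum_measureReal_preimage_singleton _ fun y _ => hU (measurableSet_singleton y),
      Finset.sum_mul]
    refine Finset.sum_congr rfl fun y hy => ?_
    by_cases h0 : μ (U ⁻¹' {y}) = 0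
    · simp [h0, Measure.real]
    · rw [shannonEntropy_cond_eq_of_indepFun hU hind _ h0]
      · rfl
      · rintro ω rfl
        rw [if_pos (Finset.mem_range.1 hy)]
  · intro y hy
    rw [shannonEntropy_cond_eq_zero hU, mul_zero]
    rintro ω rfl
    rw [if_neg (by simpa using hy), add_zero]

theorem neg_mul_log_le_of_pos {p r : ℝ} (hp : 0 ≤ p) (hr : 0 < r) :
    -(p * Real.log p) ≤ -(p * Real.log r) + (r - p) := by
  rcases hp.eq_or_lt with rfl | hp
  · simpa using hr.le
  · have h := Real.log_le_sub_one_of_pos (div_pos hr hp)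
    rw [Real.log_div hr.ne' hp.ne'] at h
    have h2 := mul_le_mul_of_nonneg_left h hp.le
    have h3 : p * (r / p - 1) = r - p := by field_simp
    nlinarith

theorem sum_geometric_le_one {c : ℝ} (hc : 0 < c) (n : ℕ) :
    ∑ a ∈ Finset.range n, (c + 1)⁻¹ * (c / (c + 1)) ^ a ≤ 1 := by
  have hne : c / (c + 1) ≠ 1 := by
    rw [Ne, div_eq_one_iff_eq (by positivity)]; linarith
  rw [← Finset.mul_sum, geom_sum_eq hne]
  have h1 : c / (c + 1) - 1 = -(c + 1)⁻¹ := by field_simp; ring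
  have h2 : 0 ≤ (c / (c + 1)) ^ n := by positivity
  rw [h1, mul_div_assoc', div_neg, mul_div_cancel_left₀ _ (by positivity)]
  linarith

/-- A natural-valued variable of mean at most `c` has at most the entropy of a geometric variable
of mean `c`. -/
theorem shannonEntropy_le_of_integral_le [IsProbabilityMeasure μ] {X : Ω → ℕ}
    (hX : Measurable X) {n : ℕ} (hn : ∀ ω, X ω < n) {c : ℝ} (hc : 0 < c) (hmean : ∫ ω, (X ω : ℝ) ∂μ ≤ c) :
    shannonEntropy μ X ≤ (Real.log (c + 1) + 1) / Real.log 2 := by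
  have hms : ∀ a, MeasurableSet (X ⁻¹' {a}) := fun a => hX (measurableSet_singleton a)
  have hrange : X ⁻¹' (Finset.range n : Set ℕ) = Set.univ := by
    ext ω; simpa using hn ω
  have hone : ∑ a ∈ Finset.range n, μ.real (X ⁻¹' {a}) = 1 := by
    rw [sum_measureReal_preimage_singleton _ fun y _ => hms y, hrange]; simp
  have hint : ∑ a ∈ Finset.range n, μ.real (X ⁻¹' {a}) * a = ∫ ω, (X ω : ℝ) ∂μ := by
    have hfun : (fun ω => (X ω : ℝ)) = fun ω => ∑ a ∈ Finset.range n,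
        (X ⁻¹' {a}).indicator (fun _ => (a : ℝ)) ω := by
      funext ω
      rw [Finset.sum_eq_single (X ω)]
      · simp
      · intro b _ hb
        simp [Ne.symm hb]
      · intro h
        exact absurd (Finset.mem_range.2 (hn ω)) h
    rw [hfun, integral_finsetSum _ fun a _ => (integrable_const _).indicator (hms a)]
    refine Finset.sum_congr rfl fun a _ => ?_
    rw [integral_indicator_const _ (hms a), smul_eq_mul]
  have hlog2 : 0 < Real.log 2 := Real.log_pos one_lt_two
  unfold shannonEntropy
  rw [tsum_eq_sum (s := Finset.range n)]
  · rw [le_div_iff₀ hlog2, Finset.sum_mul]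
    have hterm : ∀ a ∈ Finset.range n,
        -((μ (X ⁻¹' {a})).toReal * Real.logb 2 (μ (X ⁻¹' {a})).toReal) * Real.log 2 ≤
        μ.real (X ⁻¹' {a}) * Real.log (c + 1) + μ.real (X ⁻¹' {a}) * a * Real.log ((c + 1) / c) +
          ((c + 1)⁻¹ * (c / (c + 1)) ^ a - μ.real (X ⁻¹' {a})) := by
      intro a _
      have h := neg_mul_log_le_of_pos (p := μ.real (X ⁻¹' {a})) measureReal_nonneg
        (r := (c + 1)⁻¹ * (c / (c + 1)) ^ a) (by positivity)
      have hr : Real.log ((c + 1)⁻¹ * (c / (c + 1)) ^ a) =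
          -Real.log (c + 1) - a * Real.log ((c + 1) / c) := by
        rw [Real.log_mul (by positivity) (by positivity), Real.log_inv, Real.log_pow,
          ← inv_div (c + 1) c, Real.log_inv]
        ring
      rw [hr] at h
      have hl : -((μ (X ⁻¹' {a})).toReal * Real.logb 2 (μ (X ⁻¹' {a})).toReal) * Real.log 2 =
          -(μ.real (X ⁻¹' {a}) * Real.log (μ.real (X ⁻¹' {a}))) := by
        rw [Real.logb, Measure.real]; field_simp
      rw [hl]
      linarith
    refine (Finset.sum_le_sum hterm).trans ?_
    rw [Finset.sum_add_distrib, Finset.sum_add_distrib, Finset.sum_sub_distrib, ← Finset.sum_mul,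
      ← Finset.sum_mul, hone, hint]
    have hgeo := sum_geometric_le_one hc n
    have hlog : Real.log ((c + 1) / c) ≤ 1 / c := by
      refine (Real.log_le_sub_one_of_pos (by positivity)).trans_eq ?_
      field_simp; ring
    have hlog0 : 0 ≤ Real.log ((c + 1) / c) :=
      Real.log_nonneg (by rw [le_div_iff₀ hc]; linarith)
    have : (∫ ω, (X ω : ℝ) ∂μ) * Real.log ((c + 1) / c) ≤ c * (1 / c) :=
      mul_le_mul hmean hlog hlog0 hc.le
    rw [mul_one_div_cancel hc.ne'] at this
    linarith
  · intro a ha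
    have : X ⁻¹' {a} = ∅ := by
      ext ω
      simp only [Set.mem_preimage, Set.mem_singleton_iff, Set.mem_empty_iff_false, iff_false]
      rintro rfl
      exact ha (Finset.mem_range.2 (hn ω))
    simp [this]

end Entropy

section Partition

variable {ι : Type*} [DecidableEq ι]

theorem exists_subset_sum_mem_Ico {p : ι → ℝ} (hp : ∀ i, p i ≤ 1) {T : ℝ} (hT : 0 < T)
    (s : Finset ι) (hs : T ≤ ∑ i ∈ s, p i) :
    ∃ b ⊆ s, T ≤ ∑ i ∈ b, p i ∧ ∑ i ∈ b, p i < T + 1 := by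
  induction s using Finset.induction_on with
  | empty => simp at hs; linarith
  | insert a s ha ih =>
    by_cases h : T ≤ ∑ i ∈ s, p i
    · obtain ⟨b, hb, h1⟩ := ih h
      exact ⟨b, hb.trans (Finset.subset_insert a s), h1⟩
    · refine ⟨insert a s, subset_rfl, hs, ?_⟩
      rw [Finset.sum_insert ha]
      linarith [hp a]

theorem exists_finpartition_sum_mem_Ico {p : ι → ℝ} (hp : ∀ i, p i ≤ 1) {T : ℝ} (hT : 0 < T)
    (s : Finset ι) (hs : T ≤ ∑ i ∈ s, p i) :
    ∃ P : Finpartition s, ∀ b ∈ P.parts, T ≤ ∑ i ∈ b, p i ∧ ∑ i ∈ b, p i < 2 * T + 1 := by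
  induction s using Finset.strongInduction with
  | H s ih =>
    have hne : ∀ b : Finset ι, T ≤ ∑ i ∈ b, p i → b ≠ ∅ := by
      rintro b hb rfl
      simp at hb; linarith
    by_cases hbig : ∑ i ∈ s, p i < 2 * T + 1
    · refine ⟨Finpartition.indiscrete (hne s hs), fun b hb => ?_⟩
      rw [Finpartition.indiscrete_parts, Finset.mem_singleton] at hb
      exact hb ▸ ⟨hs, hbig⟩
    · obtain ⟨b, hbs, hb1, hb2⟩ := exists_subset_sum_mem_Ico hp hT s hs
      have hsum := Finset.sum_sdiff (f := p) hbs
      obtain ⟨P, hP⟩ := ih (s \ b)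
        (Finset.sdiff_ssubset hbs (Finset.nonempty_iff_ne_empty.2 (hne b hb1))) (by linarith)
      refine ⟨P.extend (hne b hb1) Finset.sdiff_disjoint (Finset.sdiff_union_of_subset hbs),
        fun x hx => ?_⟩
      rw [Finpartition.extend_parts, Finset.mem_insert] at hx
      rcases hx with rfl | hx
      · exact ⟨hb1, by linarith⟩
      · exact hP x hx

theorem exists_finpartition_sum_lt {p : ι → ℝ} (hp : ∀ i, p i ≤ 1) {T : ℝ} (hT : 0 < T)
    (s : Finset ι) (hs : s.Nonempty) :
    ∃ P : Finpartition s, (∀ b ∈ P.parts, ∑ i ∈ b, p i < 2 * T + 1) ∧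
      (P.parts.card = 1 ∨ ∀ b ∈ P.parts, T ≤ ∑ i ∈ b, p i) := by
  by_cases h : T ≤ ∑ i ∈ s, p i
  · obtain ⟨P, hP⟩ := exists_finpartition_sum_mem_Ico hp hT s h
    exact ⟨P, fun b hb => (hP b hb).2, Or.inr fun b hb => (hP b hb).1⟩
  · refine ⟨Finpartition.indiscrete hs.ne_empty, fun b hb => ?_, Or.inl (by simp)⟩
    rw [Finpartition.indiscrete_parts, Finset.mem_singleton] at hb
    rw [hb]
    linarith

end Partition

section Descr

variable {Ω : Type*} {M : ℕ}

/-- The number of indices in `B` whose source takes the value `ℓ`. -/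
def groupCount (S : Fin M → Ω → ℕ) (ℓ : ℕ) (B : Finset (Fin M)) (ω : Ω) : ℕ :=
  (B.filter fun i => S i ω = ℓ).card

theorem descr_succ (S : Fin M → Ω → ℕ) (ℓ θ : ℕ) (B : ℕ → Finset (Fin M)) (m : ℕ) :
    descr S ℓ θ B (m + 1) = fun ω => descr S ℓ θ B m ω +
      if descr S ℓ θ B m ω < θ then groupCount S ℓ (B (m + 1)) ω else 0 := rfl

theorem descr_congr {Ω' : Type*} {S : Fin M → Ω → ℕ} {S' : Fin M → Ω' → ℕ} {ω : Ω} {ω' : Ω'}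
    (ℓ θ : ℕ) {B : ℕ → Finset (Fin M)} {m : ℕ}
    (h : ∀ k ∈ Finset.Icc 1 m, ∀ i ∈ B k, S i ω = S' i ω') :
    descr S ℓ θ B m ω = descr S' ℓ θ B m ω' := by
  induction m with
  | zero => rfl
  | succ m ih =>
    have h1 := ih fun k hk => h k (Finset.Icc_subset_Icc_right (Nat.le_succ m) hk)
    have h2 : groupCount S ℓ (B (m + 1)) ω = groupCount S' ℓ (B (m + 1)) ω' := by
      unfold groupCount
      congr 1
      refine Finset.filter_congr fun i hi => ?_
      rw [h (m + 1) (by simp) i hi]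
    rw [descr_succ, descr_succ]
    simp only [h1, h2]

theorem groupCount_eq_sum_indicator (S : Fin M → Ω → ℕ) (ℓ : ℕ) (B : Finset (Fin M)) (ω : Ω) :
    (groupCount S ℓ B ω : ℝ) = ∑ i ∈ B, (S i ⁻¹' {ℓ}).indicator (fun _ => (1 : ℝ)) ω := by
  classical
  unfold groupCount
  rw [Finset.card_filter]
  push_cast
  exact Finset.sum_congr rfl fun i _ => by simp [Set.indicator_apply]

variable [MeasurableSpace Ω] {μ : Measure Ω} {S : Fin M → Ω → ℕ}

theorem measurable_groupCount (hS : ∀ i, Measurable (S i)) (ℓ : ℕ) (B : Finset (Fin M)) :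
    Measurable (groupCount S ℓ B) := by
  unfold groupCount
  simp only [Finset.card_filter]
  exact Finset.measurable_fun_sum _ fun i _ =>
    Measurable.ite (hS i (measurableSet_singleton ℓ)) measurable_const measurable_const

theorem measurable_descr (hS : ∀ i, Measurable (S i)) (ℓ θ : ℕ) (B : ℕ → Finset (Fin M)) (m : ℕ) :
    Measurable (descr S ℓ θ B m) := by
  induction m with
  | zero => exact measurable_const
  | succ m ih =>
    rw [descr_succ]
    exact ih.add (Measurable.ite (ih measurableSet_Iio) (measurable_groupCount hS _ _)
      measurable_const)

theorem indepFun_descr_groupCount (hS : ∀ i, Measurable (S i)) (hind : iIndepFun S μ) (ℓ θ : ℕ)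
    {B : ℕ → Finset (Fin M)} {m : ℕ} {C : Finset (Fin M)}
    (hB : ∀ k ∈ Finset.Icc 1 m, Disjoint (B k) C) :
    IndepFun (descr S ℓ θ B m) (groupCount S ℓ C) μ := by
  classical
  set F := (Finset.Icc 1 m).biUnion B with hF
  have hFC : Disjoint F C := (Finset.disjoint_biUnion_left _ _ _).2 hB
  let ext (G : Finset (Fin M)) (i : Fin M) (x : G → ℕ) : ℕ := if h : i ∈ G then x ⟨i, h⟩ else 0
  have h := (hind.indepFun_finset F C hFC hS).comp
    (φ := descr (ext F) ℓ θ B m) (ψ := groupCount (ext C) ℓ C)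
    (Measurable.of_discrete) (Measurable.of_discrete)
  convert h using 1
  · funext ω
    refine descr_congr ℓ θ fun k hk i hi => ?_
    have : i ∈ F := Finset.mem_biUnion.2 ⟨k, hk, hi⟩
    simp [ext, this]
  · funext ω
    simp only [groupCount, Function.comp]
    congr 1
    refine Finset.filter_congr fun i hi => ?_
    simp [ext, hi]

theorem integral_groupCount [IsProbabilityMeasure μ] (hS : ∀ i, Measurable (S i)) (ℓ : ℕ)
    (B : Finset (Fin M)) :
    ∫ ω, (groupCount S ℓ B ω : ℝ) ∂μ = ∑ i ∈ B, μ.real (S i ⁻¹' {ℓ}) := by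
  have hms : ∀ i, MeasurableSet (S i ⁻¹' {ℓ}) := fun i => hS i (measurableSet_singleton ℓ)
  simp only [groupCount_eq_sum_indicator]
  rw [integral_finsetSum _ fun i _ => (integrable_const _).indicator (hms i)]
  refine Finset.sum_congr rfl fun i _ => ?_
  rw [integral_indicator_const _ (hms i), smul_eq_mul, mul_one]

theorem variance_groupCount_le [IsProbabilityMeasure μ] (hS : ∀ i, Measurable (S i))
    (hind : iIndepFun S μ) (ℓ : ℕ) (B : Finset (Fin M)) :
    variance (fun ω => (groupCount S ℓ B ω : ℝ)) μ ≤ ∑ i ∈ B, μ.real (S i ⁻¹' {ℓ}) := by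
  have hms : ∀ i, MeasurableSet (S i ⁻¹' {ℓ}) := fun i => hS i (measurableSet_singleton ℓ)
  have hfun : (fun ω => (groupCount S ℓ B ω : ℝ)) =
      ∑ i ∈ B, (S i ⁻¹' {ℓ}).indicator (fun _ => (1 : ℝ)) := by
    funext ω
    rw [groupCount_eq_sum_indicator, Finset.sum_apply]
  rw [hfun, IndepFun.variance_sum]
  · refine Finset.sum_le_sum fun i _ => ?_
    refine (variance_le_expectation_sq
      (measurable_const.indicator (hms i)).aestronglyMeasurable).trans_eq ?_
    have : (S i ⁻¹' {ℓ}).indicator (fun _ => (1 : ℝ)) ^ 2 =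
        (S i ⁻¹' {ℓ}).indicator (fun _ => (1 : ℝ)) := by
      classical
      funext ω
      simp [Set.indicator_apply]
    rw [this, integral_indicator_const _ (hms i), smul_eq_mul, mul_one]
  · exact fun i _ => memLp_indicator_const _ (hms i) _ (Or.inr (measure_ne_top _ _))
  · intro i _ j _ hij
    exact (hind.indepFun hij).comp (φ := ({ℓ} : Set ℕ).indicator fun _ => (1 : ℝ))
      (ψ := ({ℓ} : Set ℕ).indicator fun _ => (1 : ℝ)) Measurable.of_discrete Measurable.of_discrete

theorem measureReal_groupCount_lt_le_half [IsProbabilityMeasure μ] (hS : ∀ i, Measurable (S i))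
    (hind : iIndepFun S μ) (ℓ θ : ℕ) (B : Finset (Fin M))
    (hB : 4 * (θ : ℝ) + 4 ≤ ∑ i ∈ B, μ.real (S i ⁻¹' {ℓ})) :
    μ.real {ω | groupCount S ℓ B ω < θ} ≤ 1 / 2 := by
  set v := ∑ i ∈ B, μ.real (S i ⁻¹' {ℓ}) with hv
  have hθ : (0 : ℝ) ≤ θ := Nat.cast_nonneg θ
  have hpos : 0 < v - θ := by linarith
  have hmem : MemLp (fun ω => (groupCount S ℓ B ω : ℝ)) 2 μ := by
    simp only [groupCount_eq_sum_indicator]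
    exact memLp_finsetSum _ fun i _ =>
      memLp_indicator_const _ (hS i (measurableSet_singleton ℓ)) _ (Or.inr (measure_ne_top _ _))
  have hcheb := meas_ge_le_variance_div_sq hmem hpos
  rw [integral_groupCount hS, ← hv] at hcheb
  have hsub : {ω | groupCount S ℓ B ω < θ} ⊆ {ω | v - θ ≤ |(groupCount S ℓ B ω : ℝ) - v|} := by
    intro ω hω
    have h1 : (groupCount S ℓ B ω : ℝ) < θ := by exact_mod_cast hω
    simp only [Set.mem_ofPred_eq]
    rw [abs_sub_comm]
    exact le_trans (by linarith) (le_abs_self _)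
  have hle : μ.real {ω | groupCount S ℓ B ω < θ} ≤
      variance (fun ω => (groupCount S ℓ B ω : ℝ)) μ / (v - θ) ^ 2 :=
    ENNReal.toReal_le_of_le_ofReal (div_nonneg (variance_nonneg _ _) (sq_nonneg _))
      ((measure_mono hsub).trans hcheb)
  refine hle.trans ?_
  rw [div_le_iff₀ (by positivity)]
  have hvar := variance_groupCount_le hS hind ℓ B
  nlinarith

theorem measureReal_descr_lt_le [IsProbabilityMeasure μ] (hS : ∀ i, Measurable (S i))
    (hind : iIndepFun S μ) (ℓ θ : ℕ) {B : ℕ → Finset (Fin M)} {m : ℕ}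
    (hdisj : ∀ k ∈ Finset.Icc 1 m, ∀ k' ∈ Finset.Icc 1 m, k ≠ k' → Disjoint (B k) (B k'))
    (hB : ∀ k ∈ Finset.Icc 1 m, 4 * (θ : ℝ) + 4 ≤ ∑ i ∈ B k, μ.real (S i ⁻¹' {ℓ})) :
    μ.real {ω | descr S ℓ θ B m ω < θ} ≤ (1 / 2) ^ m := by
  induction m with
  | zero => simp
  | succ m ih =>
    have hsub : Finset.Icc 1 m ⊆ Finset.Icc 1 (m + 1) := Finset.Icc_subset_Icc_right (Nat.le_succ m)
    have hmem : m + 1 ∈ Finset.Icc 1 (m + 1) := by simp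
    have hm := ih (fun k hk k' hk' => hdisj k (hsub hk) k' (hsub hk')) fun k hk => hB k (hsub hk)
    have hindep : IndepFun (descr S ℓ θ B m) (groupCount S ℓ (B (m + 1))) μ :=
      indepFun_descr_groupCount hS hind ℓ θ fun k hk =>
        hdisj k (hsub hk) (m + 1) hmem (by have := Finset.mem_Icc.1 hk; omega)
    have hincl : {ω | descr S ℓ θ B (m + 1) ω < θ} ⊆
        descr S ℓ θ B m ⁻¹' Set.Iio θ ∩ groupCount S ℓ (B (m + 1)) ⁻¹' Set.Iio θ := by
      intro ω hω
      rw [descr_succ] at hω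
      simp only [Set.mem_ofPred_eq] at hω
      simp only [Set.mem_inter_iff, Set.mem_preimage, Set.mem_Iio]
      split_ifs at hω <;> omega
    have hprod : μ.real (descr S ℓ θ B m ⁻¹' Set.Iio θ ∩
        groupCount S ℓ (B (m + 1)) ⁻¹' Set.Iio θ) =
        μ.real {ω | descr S ℓ θ B m ω < θ} * μ.real {ω | groupCount S ℓ (B (m + 1)) ω < θ} := by
      rw [Measure.real, hindep.measure_inter_preimage_eq_mul _ _ measurableSet_Iio measurableSet_Iio,
        ENNReal.toReal_mul]
      rfl
    rw [pow_succ]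
    refine (measureReal_mono hincl).trans (hprod.trans_le ?_)
    exact mul_le_mul hm
      (measureReal_groupCount_lt_le_half hS hind ℓ θ _ (hB _ hmem))
      measureReal_nonneg (by positivity)

theorem sum_condShannonEntropy_descr_lt [IsProbabilityMeasure μ] (hS : ∀ i, Measurable (S i))
    (hind : iIndepFun S μ) (ℓ θ : ℕ) {B : ℕ → Finset (Fin M)} {J : ℕ}
    (hdisj : ∀ k ∈ Finset.Icc 1 J, ∀ k' ∈ Finset.Icc 1 J, k ≠ k' → Disjoint (B k) (B k'))
    (hupper : ∀ k ∈ Finset.Icc 1 J,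
      ∑ i ∈ B k, μ.real (S i ⁻¹' {ℓ}) < 2 * (4 * (θ : ℝ) + 4) + 1)
    (hlower : J = 1 ∨ ∀ k ∈ Finset.Icc 1 J, 4 * (θ : ℝ) + 4 ≤ ∑ i ∈ B k, μ.real (S i ⁻¹' {ℓ})) :
    ∑ m ∈ Finset.Icc 1 J, condShannonEntropy μ (descr S ℓ θ B m) (descr S ℓ θ B (m - 1)) <
      (5 / 2) * Real.logb 2 (1 + (θ : ℝ)) + 12 := by
  have hθ : (0 : ℝ) ≤ θ := Nat.cast_nonneg θ
  have hlog2 : 0 < Real.log 2 := Real.log_pos one_lt_two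
  set c : ℝ := 2 * (4 * (θ : ℝ) + 4) + 1 with hc
  have hc0 : 0 < c := by positivity
  set h : ℝ := (Real.log (c + 1) + 1) / Real.log 2 with hh
  have hh0 : 0 ≤ h := div_nonneg (add_nonneg (Real.log_nonneg (by linarith)) zero_le_one) hlog2.le
  have hterm : ∀ m ∈ Finset.range J,
      condShannonEntropy μ (descr S ℓ θ B (m + 1)) (descr S ℓ θ B m) ≤ (1 / 2) ^ m * h := by
    intro m hm
    have hmJ := Finset.mem_range.1 hm
    have hmem : m + 1 ∈ Finset.Icc 1 J := by simp; omega
    have hsub : Finset.Icc 1 m ⊆ Finset.Icc 1 J := Finset.Icc_subset_Icc_right hmJ.le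
    have hindep : IndepFun (descr S ℓ θ B m) (groupCount S ℓ (B (m + 1))) μ :=
      indepFun_descr_groupCount hS hind ℓ θ fun k hk =>
        hdisj k (hsub hk) (m + 1) hmem (by have := Finset.mem_Icc.1 hk; omega)
    rw [descr_succ, condShannonEntropy_clipped_add (measurable_descr hS ℓ θ B m) hindep]
    have hent : shannonEntropy μ (groupCount S ℓ (B (m + 1))) ≤ h :=
      shannonEntropy_le_of_integral_le (measurable_groupCount hS _ _)
        (fun ω => Nat.lt_succ_of_le (Finset.card_filter_le _ _)) hc0
        (by rw [integral_groupCount hS]; exact (hupper _ hmem).le)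
    have hprob : μ.real {ω | descr S ℓ θ B m ω < θ} ≤ (1 / 2) ^ m := by
      rcases hlower with rfl | hlower
      · obtain rfl : m = 0 := by omega
        simp
      · exact measureReal_descr_lt_le hS hind ℓ θ
          (fun k hk k' hk' => hdisj k (hsub hk) k' (hsub hk')) fun k hk => hlower k (hsub hk)
    exact (mul_le_mul_of_nonneg_left hent measureReal_nonneg).trans
      (mul_le_mul_of_nonneg_right hprob hh0)
  have hreindex : ∑ m ∈ Finset.Icc 1 J,
      condShannonEntropy μ (descr S ℓ θ B m) (descr S ℓ θ B (m - 1)) =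
      ∑ m ∈ Finset.range J, condShannonEntropy μ (descr S ℓ θ B (m + 1)) (descr S ℓ θ B m) := by
    rw [Finset.range_eq_Ico]
    exact (Finset.sum_Ico_add' (fun m =>
      condShannonEntropy μ (descr S ℓ θ B m) (descr S ℓ θ B (m - 1))) 0 J 1).symm
  have hgeo : ∑ m ∈ Finset.range J, (1 / 2 : ℝ) ^ m ≤ 2 := sum_geometric_two_le J
  have hsum : ∑ m ∈ Finset.Icc 1 J,
      condShannonEntropy μ (descr S ℓ θ B m) (descr S ℓ θ B (m - 1)) ≤ 2 * h := by
    rw [hreindex]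
    refine (Finset.sum_le_sum hterm).trans ?_
    rw [← Finset.sum_mul]
    exact mul_le_mul_of_nonneg_right hgeo hh0
  refine hsum.trans_lt ?_
  have hlogθ : 0 ≤ Real.log (1 + θ) := Real.log_nonneg (by linarith)
  have hlogc : Real.log (c + 1) ≤ 4 * Real.log 2 + Real.log (1 + θ) := by
    rw [← Nat.cast_ofNat (n := 4), ← Real.log_pow, ← Real.log_mul (by norm_num) (by positivity)]
    refine Real.log_le_log (by positivity) ?_
    rw [hc]
    linarith
  have hlog2' := Real.log_two_gt_d9
  rw [hh, Real.logb, mul_div_assoc', mul_div_assoc', div_add' _ _ _ hlog2.ne',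
    div_lt_div_iff_of_pos_right hlog2]
  linarith

end Descr

/-- **Lemma 2.** For independent sources `S₁, …, S_M` taking values in `{0, …, q-1}`, any
value `ℓ` and any threshold `θ`, there exists a partition `A_1, …, A_J` of `[1:M]` into
nonempty pairwise disjoint groups such that for every cyclic shift `d ∈ {0, …, J-1}` of
the transmission order (the `m`-th step uses group `A (((m + d - 1) mod J) + 1)`), the
descriptions `U⁽ᵈ⁾` satisfy
`∑_{m=1}^{J} H(U⁽ᵈ⁾_m | U⁽ᵈ⁾_{m-1}) < (5/2) log₂(1 + θ) + 12`. -/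
theorem stmt6 {Ω : Type*} [MeasurableSpace Ω] (μ : Measure Ω) [IsProbabilityMeasure μ]
    (q M : ℕ) (hq : 2 ≤ q) (hM : 0 < M)
    (S : Fin M → Ω → ℕ) (hSmeas : ∀ i, Measurable (S i)) (hSval : ∀ i ω, S i ω < q)
    (hindep : iIndepFun S μ)
    (ℓ : ℕ) (hℓ : ℓ < q) (θ : ℕ) :
    ∃ (J : ℕ) (A : ℕ → Finset (Fin M)), 0 < J ∧
      (∀ m ∈ Finset.Icc 1 J, (A m).Nonempty) ∧
      (∀ m ∈ Finset.Icc 1 J, ∀ m' ∈ Finset.Icc 1 J, m ≠ m' → Disjoint (A m) (A m')) ∧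
      ((Finset.Icc 1 J).biUnion A = Finset.univ) ∧
      ∀ d < J,
        (∑ m ∈ Finset.Icc 1 J,
            condShannonEntropy μ
              (descr S ℓ θ (fun m' => A (((m' + d - 1) % J) + 1)) m)
              (descr S ℓ θ (fun m' => A (((m' + d - 1) % J) + 1)) (m - 1)))
          < (5 / 2) * Real.logb 2 (1 + (θ : ℝ)) + 12 := by
  classical
  have : NeZero M := ⟨hM.ne'⟩
  obtain ⟨P, hupper, hlower⟩ := exists_finpartition_sum_lt
    (p := fun i => μ.real (S i ⁻¹' {ℓ})) (fun _ => measureReal_le_one)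
    (T := 4 * (θ : ℝ) + 4) (by positivity) Finset.univ Finset.univ_nonempty
  set J := P.parts.card with hJ
  have hJ0 : 0 < J :=
    Finset.card_pos.2 (P.parts_nonempty Finset.univ_nonempty.ne_empty)
  let e := P.parts.equivFin
  let part (k : ℕ) : Finset (Fin M) := e.symm ⟨k % J, Nat.mod_lt k hJ0⟩
  have hpart : ∀ k, part k ∈ P.parts := fun k => (e.symm _).2
  have hdisj : ∀ k k', k % J ≠ k' % J → Disjoint (part k) (part k') := by
    intro k k' hne
    refine P.disjoint (hpart k) (hpart k') fun h => hne ?_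
    simpa using e.symm.injective (Subtype.ext h)
  have hmod : ∀ d, ∀ k ∈ Finset.Icc 1 J, ∀ k' ∈ Finset.Icc 1 J, k ≠ k' →
      (k + d - 1) % J ≠ (k' + d - 1) % J := by
    intro d k hk k' hk' hne h
    rw [Finset.mem_Icc] at hk hk'
    have h' : (k - 1) + d ≡ (k' - 1) + d [MOD J] := by
      rwa [← Nat.sub_add_comm hk.1, ← Nat.sub_add_comm hk'.1]
    have := (Nat.ModEq.add_right_cancel' d h').eq_of_lt_of_lt (by omega) (by omega)
    omega
  refine ⟨J, fun m => part (m - 1), hJ0, fun m _ => P.nonempty_of_mem_parts (hpart _),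
    fun m hm m' hm' hne => hdisj _ _ (by simpa using hmod 0 m hm m' hm' hne), ?_, fun d _ => ?_⟩
  · refine Finset.eq_univ_of_forall fun i => ?_
    obtain ⟨b, hb, hib⟩ := P.exists_mem (Finset.mem_univ i)
    have hlt := (e ⟨b, hb⟩).2
    refine Finset.mem_biUnion.2 ⟨e ⟨b, hb⟩ + 1, Finset.mem_Icc.2 ⟨by omega, by omega⟩, ?_⟩
    have hfin : (⟨((e ⟨b, hb⟩ : ℕ) + 1 - 1) % J, Nat.mod_lt _ hJ0⟩ : Fin J) = e ⟨b, hb⟩ :=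
      Fin.ext (Nat.mod_eq_of_lt hlt)
    change i ∈ (e.symm ⟨((e ⟨b, hb⟩ : ℕ) + 1 - 1) % J, Nat.mod_lt _ hJ0⟩ : Finset (Fin M))
    rw [hfin, Equiv.symm_apply_apply]
    exact hib
  · refine sum_condShannonEntropy_descr_lt hSmeas hindep ℓ θ
      (fun k hk k' hk' hne => hdisj _ _ ?_) (fun k _ => hupper _ (hpart _))
      (hlower.imp_right fun h k _ => h _ (hpart _))
    simpa using hmod d k hk k' hk' hne
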